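/- Monotonicity of the fourth order scheme in one dimension: Let N = 2k+1 with k ≥ 2, let L > 0, set h = 2L/(N−1) and grid points x_i = −L + (i−1)h. Let 𝓜 : [−L,L] → ℝ be continuously differentiable with 𝓜 > 0, set M_i = 𝓜(x_i), and let u₁,…,u_N be reals with u₁ = u_N = 0. Adopt the ghost conventions M_{−1} := M₃, M₀ := M₂, M_{N+1} := M_{N−1}, M_{N+2} := M_{N−2}, u_{−1} := −u₃, u₀ := −u₂, u_{N+1} := −u_{N−1}, u_{N+2} := −u_{N−2}, and the folded values ĝ_{−1} := g₃, ĝ₀ := g₂, ĝ_{N+1} := g_{N−1}, ĝ_{N+2} := g_{N−2}, with ĝ_j = g_j for 1 ≤ j ≤ N. Define the N×N real matrix A by: for odd i, (Ag)_i = M_i g_i + Δt·(−u_{i−2}ĝ_{i−2} + 4u_{i−1}ĝ_{i−1} − 4u_{i+1}ĝ_{i+1} + u_{i+2}ĝ_{i+2})/(4h) + Δt·D·[(3M_{i−2} − 4M_{i−1} + 3M_i)ĝ_{i−2} − (4M_{i−2} + 12M_i)ĝ_{i−1} + (M_{i−2} + 4M_{i−1} + 18M_i + 4M_{i+1} + M_{i+2})g_i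 − (12M_i + 4M_{i+2})ĝ_{i+1} + (3M_i − 4M_{i+1} + 3M_{i+2})ĝ_{i+2}]/(8h²); and for even i, (Ag)_i = M_i g_i + Δt·(u_{i−1}g_{i−1} − u_{i+1}g_{i+1})/(2h) + Δt·D·[−(3M_{i−1} + M_{i+1})g_{i−1} + 4(M_{i−1} + M_{i+1})g_i − (M_{i−1} + 3M_{i+1})g_{i+1}]/(4h²). Assume Δt > 0, D > 0, and (using the ghost conventions throughout): (i) for every odd i, M_i + Δt·(−u_{i−2} + 4u_{i−1} − 4u_{i+1} + u_{i+2})/(4h) > 0, and for every even i, M_i + Δt·(u_{i−1} − u_{i+1})/(2h) > 0; (ii) for every odd i, h·max{|u_{i−2}|, |u_{i−1}|, |u_i|} ≤ (1/4)·D·min{M_{i−2}, M_{i−1}, M_i} and h·max{|u_i|, |u_{i+1}|, |u_{i+2}|} ≤ (1/4)·D·min{M_i, M_{i+1}, M_{i+2}}; (iii) for every odd i with 1 ≤ i ≤ N−2, h·max_{[x_i,x_{i+2}]}|𝓜'| ≤ 0.075·min{M_i, M_{i+1}, M_{i+2}}; (iv) Δt/h² ≥ 50/D. Then A satisfies Lorenz's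 condition, so A is a product of two nonsingular M-matrices; in particular A is invertible and every entry of A⁻¹ is nonnegative. -/

import Mathlib

open Matrix BigOperators

/-- A nonsingular M-matrix: a real square matrix with nonpositive off-diagonal entries that is
invertible and whose inverse has all entries nonnegative. -/
def IsNonsingMMatrix {n : ℕ} (B : Matrix (Fin n) (Fin n) ℝ) : Prop :=
  (∀ i j, i ≠ j → B i j ≤ 0) ∧ IsUnit B ∧ ∀ i j, 0 ≤ B⁻¹ i j

/-- Folding of 1-based grid indices `−1, 0, 1, …, N, N+1, N+2` onto `Fin N` (0-based),
implementing the ghost conventions `ĝ₋₁ := g₃`, `ĝ₀ := g₂`, `ĝ_{N+1} := g_{N−1}`,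
`ĝ_{N+2} := g_{N−2}`. -/
def foldIdx4th (N : ℕ) (hN : 5 ≤ N) (j : ℤ) : Fin N :=
  if h : 1 ≤ j ∧ j ≤ (N : ℤ) then ⟨(j - 1).toNat, by omega⟩
  else if j = -1 then ⟨2, by omega⟩
  else if j = 0 then ⟨1, by omega⟩
  else if j = (N : ℤ) + 1 then ⟨N - 2, by omega⟩
  else ⟨N - 3, by omega⟩


lemma mono_of_Z {n : ℕ} (B : Matrix (Fin n) (Fin n) ℝ) (hZ : ∀ i j, i ≠ j → B i j ≤ 0)
    (hpos : ∀ i, 0 < ∑ j, B i j) (x : Fin n → ℝ) (hx : ∀ i, 0 ≤ (B *ᵥ x) i) :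
    ∀ i, 0 ≤ x i := by
  intro i0
  haveI : Nonempty (Fin n) := ⟨i0⟩
  obtain ⟨m, hm⟩ := Finite.exists_min x
  by_contra hneg
  have hxm : x m < 0 := lt_of_le_of_lt (hm i0) (not_le.mp hneg)
  have h1 : (B *ᵥ x) m ≤ (∑ j, B m j) * x m := by
    rw [Finset.sum_mul]
    change ∑ j, B m j * x j ≤ _
    refine Finset.sum_le_sum fun j _ => ?_
    by_cases hj : m = j
    · subst hj; exact le_refl _
    · exact mul_le_mul_of_nonpos_left (hm j) (hZ m j hj)
  have h2 := mul_neg_of_pos_of_neg (hpos m) hxm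
  linarith [hx m]

lemma isMM_of_rowsum {n : ℕ} (B : Matrix (Fin n) (Fin n) ℝ) (hZ : ∀ i j, i ≠ j → B i j ≤ 0)
    (hpos : ∀ i, 0 < ∑ j, B i j) : IsNonsingMMatrix B := by
  have hunit : IsUnit B := by
    rw [← Matrix.mulVec_injective_iff_isUnit]
    intro x y hxy
    have hxy' : B *ᵥ x = B *ᵥ y := hxy
    have h1 := mono_of_Z B hZ hpos (x - y) (by intro i; simp [Matrix.mulVec_sub, hxy'])
    have h2 := mono_of_Z B hZ hpos (y - x) (by intro i; simp [Matrix.mulVec_sub, hxy'])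
    funext i
    have := h1 i
    have := h2 i
    simp only [Pi.sub_apply] at *
    linarith
  refine ⟨hZ, hunit, ?_⟩
  intro i j
  have hdet : IsUnit B.det := (Matrix.isUnit_iff_isUnit_det B).mp hunit
  have h := mono_of_Z B hZ hpos (fun i => B⁻¹ i j) (by
    intro i
    have : (B *ᵥ (fun i => B⁻¹ i j)) i = (B * B⁻¹) i j := rfl
    rw [this, Matrix.mul_nonsing_inv B hdet, Matrix.one_apply]
    split_ifs <;> norm_num)
  exact h i

lemma lorenz_abs {n : ℕ} (A : Matrix (Fin n) (Fin n) ℝ) (p : Fin n → Prop)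
    (h1 : ∀ i, 0 < ∑ j, A i j)
    (h2 : ∀ l, p l → 0 < A l l) (h2' : ∀ l j, p l → j ≠ l → A l j ≤ 0)
    (h2'' : ∀ l j, p l → p j → j ≠ l → A l j = 0)
    (h3 : ∀ i l, ¬ p i → p l → A i l ≤ 0)
    (h4 : ∀ i j, ¬ p i → ¬ p j → i ≠ j →
      A i j ≤ 0 ∨ ∃ l, p l ∧ A i j * A l l ≤ A i l * A l j) :
    (∃ M1 M2 : Matrix (Fin n) (Fin n) ℝ,
        IsNonsingMMatrix M1 ∧ IsNonsingMMatrix M2 ∧ A = M1 * M2) ∧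
      IsUnit A ∧ ∀ i j, 0 ≤ A⁻¹ i j := by
  classical
  let Z : Matrix (Fin n) (Fin n) ℝ := fun i j => if ¬ p i ∧ p j then A i j / A j j else 0
  have hZdef : ∀ i j, Z i j = if ¬ p i ∧ p j then A i j / A j j else 0 := fun _ _ => rfl
  have hZle : ∀ i j, Z i j ≤ 0 := by
    intro i j
    rw [hZdef]
    split_ifs with h
    · exact div_nonpos_of_nonpos_of_nonneg (h3 i j h.1 h.2) (h2 j h.2).le
    · exact le_refl _
  have hZZ : Z * Z = 0 := by
    ext i j
    rw [Matrix.mul_apply]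
    refine Finset.sum_eq_zero fun l _ => ?_
    rw [hZdef i l, hZdef l j]
    by_cases hl : p l <;> simp [hl]
  have hP : (1 + Z) * (1 - Z) = 1 := by
    have : (1 + Z) * (1 - Z) = 1 - Z * Z := by noncomm_ring
    rw [this, hZZ, sub_zero]
  have hP' : (1 - Z) * (1 + Z) = 1 := by
    have : (1 - Z) * (1 + Z) = 1 - Z * Z := by noncomm_ring
    rw [this, hZZ, sub_zero]
  have hM1inv : (1 + Z)⁻¹ = 1 - Z := Matrix.inv_eq_right_inv hP
  have hM1 : IsNonsingMMatrix (1 + Z) := by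
    refine ⟨?_, ⟨⟨1 + Z, 1 - Z, hP, hP'⟩, rfl⟩, ?_⟩
    · intro i j hij
      simp only [Matrix.add_apply, Matrix.one_apply, hij, if_false, zero_add]
      exact hZle i j
    · intro i j
      rw [hM1inv, Matrix.sub_apply, Matrix.one_apply]
      have := hZle i j
      split_ifs <;> linarith
  have hM2e : ∀ i j, ((1 - Z) * A) i j = A i j - ∑ l, Z i l * A l j := by
    intro i j
    rw [sub_mul, one_mul, Matrix.sub_apply, Matrix.mul_apply]
  have hM2 : IsNonsingMMatrix ((1 - Z) * A) := by
    apply isMM_of_rowsum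
    · intro i j hij
      rw [hM2e]
      by_cases hi : p i
      · have : ∑ l, Z i l * A l j = 0 :=
          Finset.sum_eq_zero fun l _ => by rw [hZdef]; simp [hi]
        rw [this, sub_zero]
        exact h2' i j hi (Ne.symm hij)
      · by_cases hj : p j
        · have : ∑ l, Z i l * A l j = Z i j * A j j := by
            refine Finset.sum_eq_single j (fun l _ hl => ?_) (by simp)
            by_cases hpl : p l
            · rw [h2'' l j hpl hj (Ne.symm hl), mul_zero]
            · rw [hZdef]; simp [hpl]
          rw [this, hZdef, if_pos ⟨hi, hj⟩, div_mul_cancel₀ _ (h2 j hj).ne', sub_self]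
        · have hterm : ∀ l, 0 ≤ Z i l * A l j := by
            intro l
            by_cases hpl : p l
            · exact mul_nonneg_of_nonpos_of_nonpos (hZle i l)
                (h2' l j hpl (fun h => hj (h ▸ hpl)))
            · rw [hZdef]; simp [hpl]
          rcases h4 i j hi hj hij with h | ⟨l, hl, hle⟩
          · have := Finset.sum_nonneg (fun l (_ : l ∈ Finset.univ) => hterm l)
            linarith
          · have h5 := Finset.single_le_sum (fun l _ => hterm l) (Finset.mem_univ l)
            have h6 : A i j ≤ Z i l * A l j := by
              rw [hZdef, if_pos ⟨hi, hl⟩, div_mul_eq_mul_div, le_div_iff₀ (h2 l hl)]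
              exact hle
            linarith
    · intro i
      have : ∑ j, ((1 - Z) * A) i j = ∑ j, A i j - ∑ l, Z i l * ∑ j, A l j := by
        simp only [hM2e, Finset.sum_sub_distrib]
        rw [Finset.sum_comm]
        simp only [Finset.mul_sum]
      rw [this]
      have h5 : ∑ l, Z i l * ∑ j, A l j ≤ 0 :=
        Finset.sum_nonpos fun l _ => mul_nonpos_of_nonpos_of_nonneg (hZle i l) (h1 l).le
      linarith [h1 i]
  have hA : A = (1 + Z) * ((1 - Z) * A) := by rw [← mul_assoc, hP, one_mul]
  refine ⟨⟨_, _, hM1, hM2, hA⟩, ?_, ?_⟩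
  · rw [hA]; exact hM1.2.1.mul hM2.2.1
  · intro i j
    rw [hA, Matrix.mul_inv_rev, Matrix.mul_apply]
    exact Finset.sum_nonneg fun l _ => mul_nonneg (hM2.2.2 i l) (hM1.2.2 l j)

/-- 1-based folded index. -/
def Fv (N : ℕ) (j : ℤ) : ℤ :=
  if 1 ≤ j ∧ j ≤ (N : ℤ) then j else if j = -1 then 3 else if j = 0 then 2
  else if j = (N : ℤ) + 1 then N - 1 else N - 2

lemma fold_val (N : ℕ) (hN : 5 ≤ N) (j : ℤ) : ((foldIdx4th N hN j).1 : ℤ) = Fv N j - 1 := by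
  unfold foldIdx4th Fv
  split_ifs <;> simp <;> omega

lemma single_fold (N : ℕ) (hN : 5 ≤ N) (j : ℤ) (c : Fin N) :
    (Pi.single c 1 : Fin N → ℝ) (foldIdx4th N hN j) = if Fv N j = (c.1 : ℤ) + 1 then 1 else 0 := by
  rw [Pi.single_apply]
  have := fold_val N hN j
  congr 1
  rw [eq_iff_iff, Fin.ext_iff]
  omega

lemma core (k N : ℕ) (hNk : N = 2 * k + 1) (hN5 : 5 ≤ N)
    (A : Matrix (Fin N) (Fin N) ℝ) (d am2 am1 ap1 ap2 e b1 b2 : ℤ → ℝ)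
    (hAodd : ∀ g : Fin N → ℝ, ∀ i : Fin N, ∀ ii : ℤ, ii = (i.1 : ℤ) + 1 → Odd ii →
      A.mulVec g i = d ii * g i + am2 ii * g (foldIdx4th N hN5 (ii - 2))
        + am1 ii * g (foldIdx4th N hN5 (ii - 1)) + ap1 ii * g (foldIdx4th N hN5 (ii + 1))
        + ap2 ii * g (foldIdx4th N hN5 (ii + 2)))
    (hAeven : ∀ g : Fin N → ℝ, ∀ i : Fin N, ∀ ii : ℤ, ii = (i.1 : ℤ) + 1 → Even ii →
      A.mulVec g i = e ii * g i + b1 ii * g (foldIdx4th N hN5 (ii - 1))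
        + b2 ii * g (foldIdx4th N hN5 (ii + 1)))
    (hso : ∀ i : ℤ, 1 ≤ i → i ≤ (N : ℤ) → Odd i → 0 < d i + am2 i + am1 i + ap1 i + ap2 i)
    (hse : ∀ i : ℤ, 1 ≤ i → i ≤ (N : ℤ) → Even i → 0 < e i + b1 i + b2 i)
    (g1 : am1 1 = ap1 1) (g2 : am2 1 = ap2 1) (g3 : ap1 N = am1 N) (g4 : ap2 N = am2 N)
    (hel : ∀ i : ℤ, 1 ≤ i → i ≤ (N : ℤ) - 2 → Odd i →
      ap1 i ≤ 0 ∧ am1 (i + 2) ≤ 0 ∧ b1 (i + 1) ≤ 0 ∧ b2 (i + 1) ≤ 0 ∧ 0 < e (i + 1) ∧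
      ap2 i * e (i + 1) ≤ ap1 i * b2 (i + 1) ∧
      am2 (i + 2) * e (i + 1) ≤ am1 (i + 2) * b1 (i + 1)) :
    (∃ M1 M2 : Matrix (Fin N) (Fin N) ℝ,
        IsNonsingMMatrix M1 ∧ IsNonsingMMatrix M2 ∧ A = M1 * M2) ∧
      IsUnit A ∧ ∀ i j, 0 ≤ A⁻¹ i j := by
  have hent : ∀ i j, A i j = A.mulVec (Pi.single j 1) i := by
    intro i j; simp
  have entO : ∀ i j : Fin N, Odd ((i.1 : ℤ) + 1) → A i j =
      d (i.1 + 1) * (if (i.1 : ℤ) + 1 = j.1 + 1 then 1 else 0)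
      + am2 (i.1 + 1) * (if Fv N ((i.1 : ℤ) + 1 - 2) = j.1 + 1 then 1 else 0)
      + am1 (i.1 + 1) * (if Fv N ((i.1 : ℤ) + 1 - 1) = j.1 + 1 then 1 else 0)
      + ap1 (i.1 + 1) * (if Fv N ((i.1 : ℤ) + 1 + 1) = j.1 + 1 then 1 else 0)
      + ap2 (i.1 + 1) * (if Fv N ((i.1 : ℤ) + 1 + 2) = j.1 + 1 then 1 else 0) := by
    intro i j hi
    rw [hent, hAodd _ i _ rfl hi]
    simp only [single_fold]
    congr 5
    rw [Pi.single_apply]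
    congr 1
    rw [eq_iff_iff, Fin.ext_iff]; omega
  have entE : ∀ i j : Fin N, Even ((i.1 : ℤ) + 1) → A i j =
      e (i.1 + 1) * (if (i.1 : ℤ) + 1 = j.1 + 1 then 1 else 0)
      + b1 (i.1 + 1) * (if (i.1 : ℤ) + 1 - 1 = j.1 + 1 then 1 else 0)
      + b2 (i.1 + 1) * (if (i.1 : ℤ) + 1 + 1 = j.1 + 1 then 1 else 0) := by
    intro i j hi
    rw [hent, hAeven _ i _ rfl hi]
    simp only [single_fold]
    obtain ⟨r, hr⟩ := hi
    have hi2 := i.2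
    have f1 : Fv N ((i.1 : ℤ) + 1 - 1) = (i.1 : ℤ) + 1 - 1 := by
      unfold Fv; rw [if_pos]; omega
    have f2 : Fv N ((i.1 : ℤ) + 1 + 1) = (i.1 : ℤ) + 1 + 1 := by
      unfold Fv; rw [if_pos]; omega
    rw [f1, f2]
    congr 3
    rw [Pi.single_apply]
    congr 1
    rw [eq_iff_iff, Fin.ext_iff]; omega
  have hodd : ∀ i : Fin N, ¬ Even ((i.1 : ℤ) + 1) → Odd ((i.1 : ℤ) + 1) := by
    intro i hi; exact Int.not_even_iff_odd.mp hi
  have elE : ∀ l : Fin N, Even ((l.1 : ℤ) + 1) →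
      b1 (l.1 + 1) ≤ 0 ∧ b2 (l.1 + 1) ≤ 0 ∧ 0 < e (l.1 + 1) := by
    intro l hl
    obtain ⟨r, hr⟩ := hl
    have hl2 := l.2
    obtain ⟨-, -, p1, p2, p3, -⟩ := hel (l.1 : ℤ) (by omega) (by omega) ⟨r - 1, by omega⟩
    exact ⟨p1, p2, p3⟩
  have ap1n : ∀ i : ℤ, 1 ≤ i → i ≤ (N : ℤ) → Odd i → am1 i ≤ 0 ∧ ap1 i ≤ 0 := by
    intro i h1 hN hi
    obtain ⟨r, hr⟩ := hi
    constructor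
    · by_cases hi1 : i = 1
      · rw [hi1, g1]; exact (hel 1 (by omega) (by omega) ⟨0, by omega⟩).1
      · have := (hel (i - 2) (by omega) (by omega) ⟨r - 1, by omega⟩).2.1
        rwa [sub_add_cancel] at this
    · by_cases hiN : i = N
      · rw [hiN, g3]
        have := (hel ((N : ℤ) - 2) (by omega) (by omega) ⟨k - 1, by omega⟩).2.1
        rwa [sub_add_cancel] at this
      · exact (hel i (by omega) (by omega) ⟨r, by omega⟩).1
  apply lorenz_abs A (fun i => Even ((i.1 : ℤ) + 1))
  · intro i
    have hs : ∑ j, A i j = A.mulVec (fun _ => 1) i := by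
      simp [Matrix.mulVec, dotProduct]
    have hi2 := i.2
    rw [hs]
    by_cases hi : Even ((i.1 : ℤ) + 1)
    · rw [hAeven _ i _ rfl hi]
      simpa using hse _ (by omega) (by omega) hi
    · rw [hAodd _ i _ rfl (hodd i hi)]
      simpa using hso _ (by omega) (by omega) (hodd i hi)
  · intro l hl
    rw [entE l l hl, if_pos rfl, if_neg (by omega), if_neg (by omega)]
    linarith [(elE l hl).2.2]
  · intro l j hl hj
    obtain ⟨q1, q2, q3⟩ := elE l hl
    have : j.1 ≠ l.1 := fun h => hj (Fin.ext h)
    rw [entE l j hl, if_neg (by omega)]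
    split_ifs <;> linarith
  · intro l j hl hj hjl
    have : j.1 ≠ l.1 := fun h => hjl (Fin.ext h)
    obtain ⟨r, hr⟩ := hl
    obtain ⟨s, hs⟩ := hj
    rw [entE l j ⟨r, hr⟩, if_neg (by omega), if_neg (by omega), if_neg (by omega)]
    ring
  · intro i l hi hl
    have hio := hodd i hi
    have hi2 := i.2
    obtain ⟨q1, q2⟩ := ap1n _ (by omega) (by omega) hio
    rw [entO i l hio]
    obtain ⟨r, hr⟩ := hio
    obtain ⟨s, hs⟩ := hl
    rw [if_neg (by omega), if_neg (by unfold Fv; split_ifs <;> omega),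
      if_neg (c := Fv N ((i.1 : ℤ) + 1 + 2) = _) (by unfold Fv; split_ifs <;> omega)]
    split_ifs <;> linarith
  · intro i j hi hj hij
    have hio := hodd i hi
    have hjo := hodd j hj
    have hi2 := i.2
    have hj2 := j.2
    have hne : i.1 ≠ j.1 := fun h => hij (Fin.ext h)
    obtain ⟨r, hr⟩ := hio
    obtain ⟨s, hs⟩ := hjo
    by_cases hR : j.1 = i.1 + 2
    · right
      refine ⟨⟨i.1 + 1, by omega⟩, ⟨r + 1, by push_cast; omega⟩, ?_⟩
      obtain ⟨-, -, -, -, -, hq, -⟩ := hel ((i.1 : ℤ) + 1) (by omega) (by omega) ⟨r, hr⟩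
      rw [entE ⟨i.1 + 1, _⟩ ⟨i.1 + 1, _⟩ ⟨r + 1, by push_cast; omega⟩,
        entE ⟨i.1 + 1, _⟩ j ⟨r + 1, by push_cast; omega⟩,
        entO i j ⟨r, hr⟩, entO i _ ⟨r, hr⟩]
      push_cast
      have f1 : Fv N ((i.1 : ℤ) + 1 + 1) = (i.1 : ℤ) + 2 := by
        unfold Fv; rw [if_pos (by omega)]; omega
      have f2 : Fv N ((i.1 : ℤ) + 1 + 2) = (i.1 : ℤ) + 3 := by
        unfold Fv; rw [if_pos (by omega)]; omega
      rw [f1, f2]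
      by_cases h0 : i.1 = 0
      · have f3 : Fv N ((i.1 : ℤ) + 1 - 1) = 2 := by
          unfold Fv; rw [if_neg (by omega), if_neg (by omega), if_pos (by omega)]
        have f4 : Fv N ((i.1 : ℤ) + 1 - 2) = 3 := by
          unfold Fv; rw [if_neg (by omega), if_pos (by omega)]
        rw [f3, f4]
        have hj' : j.1 = 2 := by omega
        simp [h0, hj'] at hq ⊢
        rw [g1, g2]
        linarith
      · have f3 : Fv N ((i.1 : ℤ) + 1 - 1) = (i.1 : ℤ) := by
          unfold Fv; rw [if_pos (by omega)]; omega
        have f4 : Fv N ((i.1 : ℤ) + 1 - 2) = (i.1 : ℤ) - 1 := by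
          unfold Fv; rw [if_pos (by omega)]; omega
        rw [f3, f4, hR]
        push_cast
        repeat first
          | rw [if_pos (by omega)]
          | rw [if_neg (by omega)]
        linarith
    · by_cases hLf : i.1 = j.1 + 2
      · right
        refine ⟨⟨j.1 + 1, by omega⟩, ⟨s + 1, by push_cast; omega⟩, ?_⟩
        obtain ⟨-, -, -, -, -, -, hq⟩ := hel ((j.1 : ℤ) + 1) (by omega) (by omega) ⟨s, hs⟩
        rw [entE ⟨j.1 + 1, _⟩ ⟨j.1 + 1, _⟩ ⟨s + 1, by push_cast; omega⟩,
          entE ⟨j.1 + 1, _⟩ j ⟨s + 1, by push_cast; omega⟩,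
          entO i j ⟨r, hr⟩, entO i _ ⟨r, hr⟩]
        push_cast
        have f1 : Fv N ((i.1 : ℤ) + 1 - 1) = (j.1 : ℤ) + 2 := by
          unfold Fv; rw [if_pos (by omega)]; omega
        have f2 : Fv N ((i.1 : ℤ) + 1 - 2) = (j.1 : ℤ) + 1 := by
          unfold Fv; rw [if_pos (by omega)]; omega
        rw [f1, f2]
        have hii : (i.1 : ℤ) + 1 = (j.1 : ℤ) + 1 + 2 := by omega
        by_cases h0 : i.1 + 1 = N
        · have f3 : Fv N ((i.1 : ℤ) + 1 + 1) = (j.1 : ℤ) + 2 := by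
            unfold Fv
            rw [if_neg (by omega), if_neg (by omega), if_neg (by omega), if_pos (by omega)]
            omega
          have f4 : Fv N ((i.1 : ℤ) + 1 + 2) = (j.1 : ℤ) + 1 := by
            unfold Fv
            rw [if_neg (by omega), if_neg (by omega), if_neg (by omega), if_neg (by omega)]
            omega
          rw [f3, f4]
          have hiN : (j.1 : ℤ) + 1 + 2 = N := by omega
          rw [hii, hiN, g3, g4]
          rw [hiN] at hq
          repeat first
            | rw [if_pos (by omega)]
            | rw [if_neg (by omega)]
          linarith
        · have f3 : Fv N ((i.1 : ℤ) + 1 + 1) = (j.1 : ℤ) + 4 := by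
            unfold Fv; rw [if_pos (by omega)]; omega
          have f4 : Fv N ((i.1 : ℤ) + 1 + 2) = (j.1 : ℤ) + 5 := by
            unfold Fv; rw [if_pos (by omega)]; omega
          rw [f3, f4, hii]
          repeat first
            | rw [if_pos (by omega)]
            | rw [if_neg (by omega)]
          linarith
      · left
        rw [entO i j ⟨r, hr⟩]
        rw [if_neg (by omega), if_neg (by unfold Fv; split_ifs <;> omega),
          if_neg (by unfold Fv; split_ifs <;> omega),
          if_neg (by unfold Fv; split_ifs <;> omega),
          if_neg (by unfold Fv; split_ifs <;> omega)]
        linarith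

/-- Scaled element inequalities. -/
lemma elem_ineq (τ m a b c v1 v2 : ℝ) (hτ : 50 ≤ τ) (hm : 0 < m) (ha : m ≤ a) (hb : m ≤ b)
    (hc : m ≤ c) (hab : |b - a| ≤ 0.075 * m) (hbc : |c - b| ≤ 0.075 * m)
    (hmin : m = a ∨ m = b ∨ m = c)
    (hv1 : |v1| ≤ m / 4) (hv2 : |v2| ≤ m / 4) :
    τ * (-v1 - (12 * a + 4 * c) / 8) ≤ 0 ∧ τ * (-v2 / 2 - (a + 3 * c) / 4) ≤ 0 ∧
    0 < b + τ * (a + c) ∧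
    τ * (v2 / 4 + (3 * a - 4 * b + 3 * c) / 8) * (b + τ * (a + c)) ≤
      τ * (-v1 - (12 * a + 4 * c) / 8) * (τ * (-v2 / 2 - (a + 3 * c) / 4)) := by
  rw [abs_le] at hab hbc hv1 hv2
  have hτ0 : 0 < τ := by linarith
  have hacu : a ≤ 1.15 * m ∧ b ≤ 1.15 * m ∧ c ≤ 1.15 * m ∧
      3 * a - 4 * b + 3 * c ≤ 2.75 * m := by
    rcases hmin with h | h | h <;> refine ⟨?_, ?_, ?_, ?_⟩ <;> linarith
  obtain ⟨hau, hbu, hcu, h3⟩ := hacu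
  have e0 : 0 < b + τ * (a + c) := by
    have : 0 < τ * (a + c) := mul_pos hτ0 (by linarith)
    linarith
  refine ⟨mul_nonpos_of_nonneg_of_nonpos hτ0.le (by linarith),
    mul_nonpos_of_nonneg_of_nonpos hτ0.le (by linarith), e0, ?_⟩
  have p1 : τ * (v2 / 4 + (3 * a - 4 * b + 3 * c) / 8) ≤ τ * (0.5 * m) :=
    mul_le_mul_of_nonneg_left (by linarith) hτ0.le
  have p2 : b + τ * (a + c) ≤ τ * (2.4 * m) := by
    have h1 : τ * (a + c) ≤ τ * (2.3 * m) := mul_le_mul_of_nonneg_left (by linarith) hτ0.le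
    have h2 : 50 * m ≤ τ * m := mul_le_mul_of_nonneg_right hτ hm.le
    linarith
  have p3 : τ * (1.75 * m) ≤ τ * (v1 + (12 * a + 4 * c) / 8) :=
    mul_le_mul_of_nonneg_left (by linarith) hτ0.le
  have p4 : τ * (0.875 * m) ≤ τ * (v2 / 2 + (a + 3 * c) / 4) :=
    mul_le_mul_of_nonneg_left (by linarith) hτ0.le
  have hτm : 0 < τ * m := mul_pos hτ0 hm
  calc _ ≤ τ * (0.5 * m) * (τ * (2.4 * m)) := by
        refine mul_le_mul p1 p2 e0.le (by positivity)
    _ ≤ τ * (1.75 * m) * (τ * (0.875 * m)) := by nlinarith [mul_pos hτm hτm]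
    _ ≤ τ * (v1 + (12 * a + 4 * c) / 8) * (τ * (v2 / 2 + (a + 3 * c) / 4)) := by
        refine mul_le_mul p3 p4 (by positivity) ?_
        exact le_trans (by positivity) p3
    _ = _ := by ring


/-- **Monotonicity of the fourth order scheme in one dimension.** Let `N = 2k+1` (`k ≥ 2`),
`h = 2L/(N−1)`, grid points `x_i = −L + (i−1)h`, `M_i = 𝓜(x_i)` for the positive `C¹`
invariant measure `𝓜`, and velocity values `u_i` with `u₁ = u_N = 0`, with the ghost
conventions `M₋₁ = M₃`, `M₀ = M₂`, `M_{N+1} = M_{N−1}`, `M_{N+2} = M_{N−2}`,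
`u₋₁ = −u₃`, `u₀ = −u₂`, `u_{N+1} = −u_{N−1}`, `u_{N+2} = −u_{N−2}`. Let `A` be the coefficient
matrix of the fourth order backward Euler finite difference scheme (knot stencil at odd grid
indices, midpoint stencil at even grid indices; grid index of `i : Fin N` is `i+1`). Assume
(i) positive row sums of `A_d + A^z`; (ii) `h·max|u| ≤ (D/4)·min M` on each element;
(iii) `h·max_{[x_i,x_{i+2}]}|𝓜'| ≤ 0.075·min M` on each element; (iv) `Δt/h² ≥ 50/D`.
Then `A` satisfies Lorenz's condition, hence is a product of two nonsingular M-matrices;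
in particular `A` is invertible and every entry of `A⁻¹` is nonnegative. -/
theorem stmt_8 (k N : ℕ) (hk : 2 ≤ k) (hNk : N = 2 * k + 1) (hN5 : 5 ≤ N)
    (L h Δt D : ℝ) (hL : 0 < L) (hh : h = 2 * L / ((N : ℝ) - 1))
    (hΔt : 0 < Δt) (hD : 0 < D)
    (𝓜 : ℝ → ℝ)
    (h𝓜diff : ∀ y ∈ Set.Icc (-L) L, DifferentiableAt ℝ 𝓜 y)
    (h𝓜cont : ContinuousOn (deriv 𝓜) (Set.Icc (-L) L))
    (h𝓜pos : ∀ y ∈ Set.Icc (-L) L, 0 < 𝓜 y)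
    (M u : ℤ → ℝ)
    (hMval : ∀ j : ℤ, 1 ≤ j → j ≤ (N : ℤ) → M j = 𝓜 (-L + ((j : ℝ) - 1) * h))
    (hMg1 : M (-1) = M 3) (hMg2 : M 0 = M 2)
    (hMg3 : M ((N : ℤ) + 1) = M ((N : ℤ) - 1)) (hMg4 : M ((N : ℤ) + 2) = M ((N : ℤ) - 2))
    (hu1 : u 1 = 0) (huN : u (N : ℤ) = 0)
    (hug1 : u (-1) = -u 3) (hug2 : u 0 = -u 2)
    (hug3 : u ((N : ℤ) + 1) = -u ((N : ℤ) - 1)) (hug4 : u ((N : ℤ) + 2) = -u ((N : ℤ) - 2))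
    (A : Matrix (Fin N) (Fin N) ℝ)
    (hAodd : ∀ g : Fin N → ℝ, ∀ i : Fin N, ∀ ii : ℤ, ii = (i.1 : ℤ) + 1 → Odd ii →
      A.mulVec g i =
        M ii * g i
        + Δt * (-(u (ii - 2)) * g (foldIdx4th N hN5 (ii - 2))
            + 4 * u (ii - 1) * g (foldIdx4th N hN5 (ii - 1))
            - 4 * u (ii + 1) * g (foldIdx4th N hN5 (ii + 1))
            + u (ii + 2) * g (foldIdx4th N hN5 (ii + 2))) / (4 * h)
        + Δt * D * ((3 * M (ii - 2) - 4 * M (ii - 1) + 3 * M ii) *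
              g (foldIdx4th N hN5 (ii - 2))
            - (4 * M (ii - 2) + 12 * M ii) * g (foldIdx4th N hN5 (ii - 1))
            + (M (ii - 2) + 4 * M (ii - 1) + 18 * M ii + 4 * M (ii + 1) + M (ii + 2)) * g i
            - (12 * M ii + 4 * M (ii + 2)) * g (foldIdx4th N hN5 (ii + 1))
            + (3 * M ii - 4 * M (ii + 1) + 3 * M (ii + 2)) *
              g (foldIdx4th N hN5 (ii + 2))) / (8 * h ^ 2))
    (hAeven : ∀ g : Fin N → ℝ, ∀ i : Fin N, ∀ ii : ℤ, ii = (i.1 : ℤ) + 1 → Even ii →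
      A.mulVec g i =
        M ii * g i
        + Δt * (u (ii - 1) * g (foldIdx4th N hN5 (ii - 1))
            - u (ii + 1) * g (foldIdx4th N hN5 (ii + 1))) / (2 * h)
        + Δt * D * (-(3 * M (ii - 1) + M (ii + 1)) * g (foldIdx4th N hN5 (ii - 1))
            + 4 * (M (ii - 1) + M (ii + 1)) * g i
            - (M (ii - 1) + 3 * M (ii + 1)) * g (foldIdx4th N hN5 (ii + 1))) / (4 * h ^ 2))
    (cond1odd : ∀ i : ℤ, 1 ≤ i → i ≤ (N : ℤ) → Odd i →
      0 < M i + Δt * (-(u (i - 2)) + 4 * u (i - 1) - 4 * u (i + 1) + u (i + 2)) / (4 * h))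
    (cond1even : ∀ i : ℤ, 1 ≤ i → i ≤ (N : ℤ) → Even i →
      0 < M i + Δt * (u (i - 1) - u (i + 1)) / (2 * h))
    (cond2 : ∀ i : ℤ, 1 ≤ i → i ≤ (N : ℤ) → Odd i →
      h * max |u (i - 2)| (max |u (i - 1)| |u i|) ≤
          (1 / 4) * D * min (M (i - 2)) (min (M (i - 1)) (M i)) ∧
        h * max |u i| (max |u (i + 1)| |u (i + 2)|) ≤
          (1 / 4) * D * min (M i) (min (M (i + 1)) (M (i + 2))))
    (cond3 : ∀ i : ℤ, 1 ≤ i → i ≤ (N : ℤ) - 2 → Odd i →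
      ∀ y ∈ Set.Icc (-L + ((i : ℝ) - 1) * h) (-L + ((i : ℝ) + 1) * h),
        h * |deriv 𝓜 y| ≤ 0.075 * min (M i) (min (M (i + 1)) (M (i + 2))))
    (cond4 : Δt / h ^ 2 ≥ 50 / D) :
    (∃ M1 M2 : Matrix (Fin N) (Fin N) ℝ,
        IsNonsingMMatrix M1 ∧ IsNonsingMMatrix M2 ∧ A = M1 * M2) ∧
      IsUnit A ∧ ∀ i j, 0 ≤ A⁻¹ i j := by
  have hNr : (N : ℝ) - 1 = 2 * k := by rw [hNk]; push_cast; ring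
  have hkr : (2 : ℝ) ≤ k := by exact_mod_cast hk
  have hh0 : 0 < h := by rw [hh, hNr]; positivity
  have hLh : 2 * L = ((N : ℝ) - 1) * h := by
    rw [hh, hNr]; field_simp
  have hτ : 50 ≤ Δt * D / h ^ 2 := by
    have := mul_le_mul_of_nonneg_right cond4 hD.le
    rw [div_mul_cancel₀ _ hD.ne'] at this
    calc (50 : ℝ) ≤ Δt / h ^ 2 * D := this
      _ = _ := by ring
  have hpt : ∀ j : ℤ, 1 ≤ j → j ≤ (N : ℤ) → -L + ((j : ℝ) - 1) * h ∈ Set.Icc (-L) L := by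
    intro j h1 h2
    have h1' : (1 : ℝ) ≤ j := by exact_mod_cast h1
    have h2' : (j : ℝ) ≤ N := by exact_mod_cast h2
    constructor
    · nlinarith
    · nlinarith
  have hMpos : ∀ j : ℤ, 1 ≤ j → j ≤ (N : ℤ) → 0 < M j := by
    intro j h1 h2
    rw [hMval j h1 h2]; exact h𝓜pos _ (hpt j h1 h2)
  -- mean value bound
  have hmvt : ∀ i : ℤ, 1 ≤ i → i ≤ (N : ℤ) - 2 → Odd i →
      ∀ j : ℤ, i ≤ j → j ≤ i + 1 →
      |M (j + 1) - M j| ≤ 0.075 * min (M i) (min (M (i + 1)) (M (i + 2))) := by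
    intro i h1 h2 hi j hj1 hj2
    have ha := hpt j (by omega) (by omega)
    have hb := hpt (j + 1) (by omega) (by omega)
    have hj1' : (i : ℝ) ≤ j := by exact_mod_cast hj1
    have hj2' : (j : ℝ) ≤ i + 1 := by exact_mod_cast hj2
    rw [hMval j (by omega) (by omega), hMval (j + 1) (by omega) (by omega)]
    set p := -L + ((j : ℝ) - 1) * h with hp
    set q := -L + (((j + 1 : ℤ) : ℝ) - 1) * h with hq
    have hqp : q - p = h := by rw [hp, hq]; push_cast; ring
    have hplq : p < q := by linarith
    have hsub : Set.Icc p q ⊆ Set.Icc (-L) L := Set.Icc_subset_Icc ha.1 hb.2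
    obtain ⟨y, hy, hyd⟩ := exists_deriv_eq_slope 𝓜 hplq
      (fun z hz => (h𝓜diff z (hsub hz)).continuousAt.continuousWithinAt)
      (fun z hz => (h𝓜diff z (hsub (Set.Ioo_subset_Icc_self hz))).differentiableWithinAt)
    have hc := cond3 i h1 h2 hi y ⟨by nlinarith [hy.1], by
      have := hy.2
      rw [hq] at this
      push_cast at this
      nlinarith⟩
    rw [hqp] at hyd
    have : 𝓜 q - 𝓜 p = h * deriv 𝓜 y := by rw [hyd]; field_simp
    rw [this, abs_mul, abs_of_pos hh0]
    exact hc
  have hpar : ∀ i : ℤ, Odd i → Odd (i + 2) := fun i hi => by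
    obtain ⟨r, hr⟩ := hi; exact ⟨r + 1, by omega⟩
  refine core k N hNk hN5 A
    (fun i => M i + Δt * D * (M (i - 2) + 4 * M (i - 1) + 18 * M i + 4 * M (i + 1) + M (i + 2))
      / (8 * h ^ 2))
    (fun i => Δt * (-(u (i - 2))) / (4 * h)
      + Δt * D * (3 * M (i - 2) - 4 * M (i - 1) + 3 * M i) / (8 * h ^ 2))
    (fun i => Δt * (4 * u (i - 1)) / (4 * h)
      - Δt * D * (4 * M (i - 2) + 12 * M i) / (8 * h ^ 2))
    (fun i => -(Δt * (4 * u (i + 1)) / (4 * h))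
      - Δt * D * (12 * M i + 4 * M (i + 2)) / (8 * h ^ 2))
    (fun i => Δt * u (i + 2) / (4 * h)
      + Δt * D * (3 * M i - 4 * M (i + 1) + 3 * M (i + 2)) / (8 * h ^ 2))
    (fun i => M i + Δt * D * (4 * (M (i - 1) + M (i + 1))) / (4 * h ^ 2))
    (fun i => Δt * u (i - 1) / (2 * h)
      - Δt * D * (3 * M (i - 1) + M (i + 1)) / (4 * h ^ 2))
    (fun i => -(Δt * u (i + 1) / (2 * h))
      - Δt * D * (M (i - 1) + 3 * M (i + 1)) / (4 * h ^ 2))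
    ?_ ?_ ?_ ?_ ?_ ?_ ?_ ?_ ?_
  · intro g i ii hii ho
    rw [hAodd g i ii hii ho]
    ring
  · intro g i ii hii ho
    rw [hAeven g i ii hii ho]
    ring
  · intro i h1 h2 ho
    refine lt_of_lt_of_eq (cond1odd i h1 h2 ho) ?_
    ring
  · intro i h1 h2 ho
    refine lt_of_lt_of_eq (cond1even i h1 h2 ho) ?_
    ring
  · norm_num [hMg1, hug2]
    ring
  · norm_num [hMg1, hMg2, hug1]
    ring
  · simp only [hMg4, hug3]
    ring
  · simp only [hMg3, hMg4, hug4]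
    ring
  · intro i h1 h2 ho
    have c2 := (cond2 i h1 (by omega) ho).2
    have m1 := hmvt i h1 h2 ho i (le_refl _) (by omega)
    have m2 := hmvt i h1 h2 ho (i + 1) (by omega) (le_refl _)
    have q1 := hMpos i (by omega) (by omega)
    have q2 := hMpos (i + 1) (by omega) (by omega)
    have q3 := hMpos (i + 2) (by omega) (by omega)
    have s1 : i + 1 - 1 = i := by ring
    have s2 : i + 1 + 1 = i + 2 := by ring
    have s3 : i + 2 - 2 = i := by ring
    have s4 : i + 2 - 1 = i + 1 := by ring
    rw [s2] at m2
    simp only [s1, s2, s3, s4]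
    generalize hmdef : min (M i) (min (M (i + 1)) (M (i + 2))) = m at c2 m1 m2
    have hm0 : 0 < m := by rw [← hmdef]; exact lt_min q1 (lt_min q2 q3)
    have ma : m ≤ M i := by rw [← hmdef]; exact min_le_left _ _
    have mb : m ≤ M (i + 1) := by
      rw [← hmdef]; exact (min_le_right _ _).trans (min_le_left _ _)
    have mc : m ≤ M (i + 2) := by
      rw [← hmdef]; exact (min_le_right _ _).trans (min_le_right _ _)
    have mm : m = M i ∨ m = M (i + 1) ∨ m = M (i + 2) := by
      rw [← hmdef]
      rcases min_choice (M i) (min (M (i + 1)) (M (i + 2))) with h | h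
      · left; exact h
      · right; rw [h]; exact min_choice _ _
    have hv : ∀ w : ℝ, |w| ≤ max |u i| (max |u (i + 1)| |u (i + 2)|) → |h * w / D| ≤ m / 4 := by
      intro w hw
      have := mul_le_mul_of_nonneg_left hw hh0.le
      rw [abs_div, abs_mul, abs_of_pos hh0, abs_of_pos hD, div_le_iff₀ hD]
      linarith
    have v0 := hv (u i) (le_max_left _ _)
    have v1 := hv (u (i + 1)) ((le_max_left _ _).trans (le_max_right _ _))
    have v2 := hv (u (i + 2)) ((le_max_right _ _).trans (le_max_right _ _))
    obtain ⟨r1, r2, r3, r4⟩ := elem_ineq _ m _ _ _ _ _ hτ hm0 ma mb mc m1 m2 mm v1 v2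
    obtain ⟨t1, t2, t3, t4⟩ := elem_ineq (Δt * D / h ^ 2) m (M (i + 2)) (M (i + 1)) (M i)
      (-(h * u (i + 1) / D)) (-(h * u i / D)) hτ hm0 mc mb ma
      (by rwa [abs_sub_comm]) (by rwa [abs_sub_comm])
      (by tauto) (by rwa [abs_neg]) (by rwa [abs_neg])
    have hD' := hD.ne'
    have hh' := hh0.ne'
    have E1 : ∀ w X : ℝ, -(Δt * (4 * w) / (4 * h)) - Δt * D * X / (8 * h ^ 2)
        = Δt * D / h ^ 2 * (-(h * w / D) - X / 8) := by
      intro w X; field_simp; try ring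
    have E2 : ∀ w X : ℝ, Δt * (4 * w) / (4 * h) - Δt * D * X / (8 * h ^ 2)
        = Δt * D / h ^ 2 * (-(-(h * w / D)) - X / 8) := by
      intro w X; field_simp; try ring
    have E3 : ∀ w X : ℝ, Δt * w / (2 * h) - Δt * D * X / (4 * h ^ 2)
        = Δt * D / h ^ 2 * (-(-(h * w / D)) / 2 - X / 4) := by
      intro w X; field_simp; try ring
    have E4 : ∀ w X : ℝ, -(Δt * w / (2 * h)) - Δt * D * X / (4 * h ^ 2)
        = Δt * D / h ^ 2 * (-(h * w / D) / 2 - X / 4) := by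
      intro w X; field_simp; try ring
    have E5 : ∀ X : ℝ, Δt * D * (4 * X) / (4 * h ^ 2) = Δt * D / h ^ 2 * X := by
      intro X; field_simp
    have E6 : ∀ w X : ℝ, Δt * w / (4 * h) + Δt * D * X / (8 * h ^ 2)
        = Δt * D / h ^ 2 * ((h * w / D) / 4 + X / 8) := by
      intro w X; field_simp; try ring
    rw [E1, E2, E3, E4, E5, E6, E6]
    refine ⟨r1, ?_, ?_, r2, r3, r4, ?_⟩
    · convert t1 using 3; ring
    · convert t2 using 3; ring
    · convert t4 using 2 <;> ring
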